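/- Let ρ1 ∈ (0,1) and ρ2 ∈ (0,1−ρ1). Then the matrix R is invertible and R·A·R⁻¹ = diag(1−2ρ1, 1−2(ρ1+ρ2)); equivalently, R·A = diag(1−2ρ1, 1−2(ρ1+ρ2))·R. -/

import Mathlib

open Matrix

/-- The Jacobian of the average current of the two-species TASEP. -/
def matA (ρ1 ρ2 : ℝ) : Matrix (Fin 2) (Fin 2) ℝ :=
  !![1 - 2*ρ1, 0; -2*ρ2, 1 - 2*(ρ1 + ρ2)]

/-- The normal-mode transformation matrix of the two-species TASEP. -/
noncomputable def matR (ρ1 ρ2 : ℝ) : Matrix (Fin 2) (Fin 2) ℝ :=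
  !![1 / Real.sqrt (ρ1*(1 - ρ1)), 0;
     1 / Real.sqrt ((ρ1 + ρ2)*(1 - ρ1 - ρ2)), 1 / Real.sqrt ((ρ1 + ρ2)*(1 - ρ1 - ρ2))]

/-- R is invertible and diagonalises A: R·A·R⁻¹ = diag(1−2ρ1, 1−2(ρ1+ρ2)),
equivalently R·A = diag(1−2ρ1, 1−2(ρ1+ρ2))·R. -/
theorem matR_diagonalises_matA
    (ρ1 ρ2 : ℝ) (h1 : ρ1 ∈ Set.Ioo (0:ℝ) 1) (h2 : ρ2 ∈ Set.Ioo (0:ℝ) (1 - ρ1)) :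
    IsUnit (matR ρ1 ρ2) ∧
      matR ρ1 ρ2 * matA ρ1 ρ2 * (matR ρ1 ρ2)⁻¹
        = Matrix.diagonal ![1 - 2*ρ1, 1 - 2*(ρ1 + ρ2)] ∧
      matR ρ1 ρ2 * matA ρ1 ρ2
        = Matrix.diagonal ![1 - 2*ρ1, 1 - 2*(ρ1 + ρ2)] * matR ρ1 ρ2 := by
  obtain ⟨ha, hb⟩ := h1
  obtain ⟨hc, hd⟩ := h2
  have p1 : 0 < Real.sqrt (ρ1*(1 - ρ1)) :=
    Real.sqrt_pos.mpr (mul_pos ha (by linarith))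
  have p2 : 0 < Real.sqrt ((ρ1 + ρ2)*(1 - ρ1 - ρ2)) :=
    Real.sqrt_pos.mpr (mul_pos (by linarith) (by linarith))
  have hdet : IsUnit (matR ρ1 ρ2).det := by
    rw [isUnit_iff_ne_zero, matR, Matrix.det_fin_two_of, zero_mul, sub_zero]
    positivity
  have hcomm : matR ρ1 ρ2 * matA ρ1 ρ2
        = Matrix.diagonal ![1 - 2*ρ1, 1 - 2*(ρ1 + ρ2)] * matR ρ1 ρ2 := by
    ext i j
    rw [Matrix.diagonal_mul]
    fin_cases i <;> fin_cases j <;>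
      simp [matR, matA, Matrix.mul_apply, Fin.sum_univ_two] <;> ring
  refine ⟨(Matrix.isUnit_iff_isUnit_det _).mpr hdet, ?_, hcomm⟩
  rw [hcomm, Matrix.mul_assoc, Matrix.mul_nonsing_inv _ hdet, Matrix.mul_one]
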